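/- Let n ≥ 1 and let p₀, p₁, …, p_{n+1} be points of ℝⁿ × ℝ. There exists a map f(x, t) = (x + t·b + c, a t + d), with b, c ∈ ℝⁿ and a, d ∈ ℝ, a > 0 (i.e., an element of the group (𝒯ᶜ_st, 𝒜_t) of time-independent spatio-temporal translations), such that f(q_j) = p_j for all 0 ≤ j ≤ n+1, where (q₀, …, q_{n+1}) is the standard coordinate system of ℝⁿ × ℝ, if and only if: (i) for every 1 ≤ i ≤ n, pᵢ = p₀ + (eᵢ, 0), i.e., the spatial part of pᵢ is the spatial part of p₀ plus the i-th standard basis vector and pᵢ is co-temporal with p₀; and (ii) the temporal coordinate of p₀ is strictly smaller than the temporal coordinate of p_{n+1}. -/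

import Mathlib

/-- The standard coordinate system `(q₀, q₁, …, qₙ, q_{n+1})` of `ℝⁿ × ℝ`:
`q₀ = (0,0)`, `qᵢ = (eᵢ, 0)` for `1 ≤ i ≤ n`, and `q_{n+1} = (0,1)`. -/
noncomputable def stdCoordSys (n : ℕ) : Fin (n + 2) → EuclideanSpace ℝ (Fin n) × ℝ :=
  fun j =>
    if _ : (j : ℕ) = 0 then (0, 0)
    else if h' : (j : ℕ) ≤ n then
      (EuclideanSpace.single (⟨(j : ℕ) - 1, by omega⟩ : Fin n) 1, 0)
    else (0, 1)

theorem stdCoordSys_zero (n : ℕ) : stdCoordSys n 0 = (0, 0) := by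
  simp [stdCoordSys]

theorem stdCoordSys_of_val_eq_add_one {n : ℕ} {j : Fin (n + 2)} {i : Fin n}
    (h : (j : ℕ) = i + 1) : stdCoordSys n j = (EuclideanSpace.single i 1, 0) := by
  have hj : (j : ℕ) ≤ n := h ▸ i.isLt
  simp only [stdCoordSys]
  rw [dif_neg (by simp [h]), dif_pos hj]
  simp [h]

theorem stdCoordSys_last (n : ℕ) : stdCoordSys n (Fin.last (n + 1)) = (0, 1) := by
  simp [stdCoordSys]

/-- `(p₀, …, p_{n+1})` is the image of the standard coordinate system of
`ℝⁿ × ℝ` under an element of `(𝒯ᶜ_st, 𝒜_t)` iff for every `1 ≤ i ≤ n` we have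
`pᵢ = p₀ + (eᵢ, 0)`, and the temporal coordinate of `p₀` is strictly smaller than that
of `p_{n+1}`. -/
theorem image_stdCoordSys_timeIndependentTranslation_iff (n : ℕ) (hn : 1 ≤ n)
    (p : Fin (n + 2) → EuclideanSpace ℝ (Fin n) × ℝ) :
    (∃ (b c : EuclideanSpace ℝ (Fin n)) (a d : ℝ),
        0 < a ∧
        ∀ j : Fin (n + 2),
          ((stdCoordSys n j).1 + (stdCoordSys n j).2 • b + c,
            a * (stdCoordSys n j).2 + d) = p j)
      ↔ ((∀ j : Fin (n + 2), ∀ h1 : 1 ≤ (j : ℕ), ∀ h2 : (j : ℕ) ≤ n,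
            p j = p 0 + (EuclideanSpace.single (⟨(j : ℕ) - 1, by omega⟩ : Fin n) 1, 0)) ∧
         (p 0).2 < (p (Fin.last (n + 1))).2) := by
  constructor
  · rintro ⟨b, c, a, d, ha, h⟩
    have h0 : (c, d) = p 0 := by simpa [stdCoordSys_zero] using h 0
    have hlast : (b + c, a + d) = p (Fin.last (n + 1)) := by
      simpa [stdCoordSys_last] using h (Fin.last (n + 1))
    refine ⟨fun j h1 h2 => ?_, ?_⟩
    · rw [← h j, ← h0,
        stdCoordSys_of_val_eq_add_one (i := ⟨j - 1, by omega⟩) (Nat.sub_add_cancel h1).symm]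
      simp [add_comm]
    · rw [← h0, ← hlast]
      simpa using ha
  · rintro ⟨hspace, htime⟩
    refine ⟨(p (Fin.last (n + 1))).1 - (p 0).1, (p 0).1,
      (p (Fin.last (n + 1))).2 - (p 0).2, (p 0).2, sub_pos.mpr htime, fun j => ?_⟩
    by_cases h1 : 1 ≤ (j : ℕ)
    · by_cases h2 : (j : ℕ) ≤ n
      · rw [stdCoordSys_of_val_eq_add_one (i := ⟨j - 1, by omega⟩) (Nat.sub_add_cancel h1).symm,
          hspace j h1 h2]
        ext <;> simp [add_comm]
      · obtain rfl : j = Fin.last (n + 1) := Fin.ext (by rw [Fin.val_last]; omega)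
        simp [stdCoordSys_last]
    · obtain rfl : j = 0 := Fin.ext (by rw [Fin.val_zero]; omega)
      simp [stdCoordSys_zero]
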